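/- arXiv:2604.11346 — 2 statements merged into one kernel-verified Lean document; each statement's English description precedes it below -/
import Mathlib

section
/- Let A be a real n×n matrix and m, L > 0 such that wᵀ Sym(A) w ≥ (m/2)‖w‖² for all w ∈ ℝⁿ and ‖A‖₂ ≤ L. Then A is invertible and for every w ∈ ℝⁿ, wᵀ Sym(A⁻¹) w ≥ (m/(2L²))‖w‖². Equivalently, wᵀ Sym(−A⁻¹) w ≤ −(m/2)(1/L)²‖w‖². -/
open scoped RealInnerProductSpace Matrix

/-- Symmetrization `(A + Aᵀ)/2` of a square real matrix. -/
noncomputable def symMat {n : ℕ} (A : Matrix (Fin n) (Fin n) ℝ) : Matrix (Fin n) (Fin n) ℝ :=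
  (1 / 2 : ℝ) • (A + Aᵀ)

/-- The action of a matrix on Euclidean space. -/
noncomputable def mApply {n : ℕ} (A : Matrix (Fin n) (Fin n) ℝ)
    (w : EuclideanSpace ℝ (Fin n)) : EuclideanSpace ℝ (Fin n) :=
  Matrix.toEuclideanCLM (𝕜 := ℝ) A w

/-- The spectral norm (operator 2-norm) of a square real matrix. -/
noncomputable def specNorm {n : ℕ} (A : Matrix (Fin n) (Fin n) ℝ) : ℝ :=
  ‖(Matrix.toEuclideanCLM (𝕜 := ℝ) A :
      EuclideanSpace ℝ (Fin n) →L[ℝ] EuclideanSpace ℝ (Fin n))‖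

/-- The quadratic form of a matrix agrees with that of its symmetrization. -/
theorem inner_mApply_symMat {n : ℕ} (A : Matrix (Fin n) (Fin n) ℝ)
    (w : EuclideanSpace ℝ (Fin n)) : ⟪w, mApply (symMat A) w⟫ = ⟪w, mApply A w⟫ := by
  have h : w.ofLp ⬝ᵥ Aᵀ *ᵥ w.ofLp = w.ofLp ⬝ᵥ A *ᵥ w.ofLp := by
    rw [Matrix.mulVec_transpose, dotProduct_comm, Matrix.dotProduct_mulVec]
  simp only [mApply, symMat, Matrix.inner_toEuclideanCLM, Matrix.smul_mulVec, Matrix.add_mulVec,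
    dotProduct_smul, dotProduct_add, h, smul_eq_mul]
  ring

theorem mApply_mul {n : ℕ} (A B : Matrix (Fin n) (Fin n) ℝ) (w : EuclideanSpace ℝ (Fin n)) :
    mApply (A * B) w = mApply A (mApply B w) := by
  simp [mApply]

theorem mApply_one {n : ℕ} (w : EuclideanSpace ℝ (Fin n)) : mApply 1 w = w := by
  simp [mApply]

theorem mApply_neg {n : ℕ} (A : Matrix (Fin n) (Fin n) ℝ) (w : EuclideanSpace ℝ (Fin n)) :
    mApply (-A) w = -mApply A w := by
  simp [mApply]

theorem norm_mApply_le {n : ℕ} (A : Matrix (Fin n) (Fin n) ℝ) (w : EuclideanSpace ℝ (Fin n)) :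
    ‖mApply A w‖ ≤ specNorm A * ‖w‖ :=
  ContinuousLinearMap.le_opNorm _ w

/-- A matrix whose quadratic form is coercive is invertible. -/
theorem isUnit_of_coercive {n : ℕ} {A : Matrix (Fin n) (Fin n) ℝ} {c : ℝ} (hc : 0 < c)
    (h : ∀ w : EuclideanSpace ℝ (Fin n), c * ‖w‖ ^ 2 ≤ ⟪w, mApply A w⟫) : IsUnit A := by
  rw [← Matrix.mulVec_injective_iff_isUnit]
  refine (injective_iff_map_eq_zero A.mulVecLin).2 fun v hv => ?_
  have hv' : A *ᵥ v = 0 := hv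
  have h0 := h (WithLp.toLp 2 v)
  rw [mApply, Matrix.toEuclideanCLM_toLp, hv', WithLp.toLp_zero, inner_zero_right] at h0
  have h1 : ‖WithLp.toLp 2 v‖ ^ 2 = 0 :=
    le_antisymm (nonpos_of_mul_nonpos_right h0 hc) (sq_nonneg _)
  simpa using h1

theorem stmt8 {n : ℕ} (A : Matrix (Fin n) (Fin n) ℝ) (m L : ℝ) (hm : 0 < m) (hL : 0 < L)
    (hsym : ∀ w : EuclideanSpace ℝ (Fin n), ⟪w, mApply (symMat A) w⟫ ≥ m / 2 * ‖w‖ ^ 2)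
    (hAL : specNorm A ≤ L) :
    IsUnit A ∧
    (∀ w : EuclideanSpace ℝ (Fin n), ⟪w, mApply (symMat A⁻¹) w⟫ ≥ m / (2 * L ^ 2) * ‖w‖ ^ 2) ∧
    ∀ w : EuclideanSpace ℝ (Fin n),
      ⟪w, mApply (symMat (-A⁻¹)) w⟫ ≤ -(m / 2) * (1 / L) ^ 2 * ‖w‖ ^ 2 := by
  simp only [inner_mApply_symMat] at hsym ⊢
  have hA : IsUnit A := isUnit_of_coercive (half_pos hm) hsym
  have key : ∀ w : EuclideanSpace ℝ (Fin n),
      m / (2 * L ^ 2) * ‖w‖ ^ 2 ≤ ⟪w, mApply A⁻¹ w⟫ := by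
    intro w
    have hAu : mApply A (mApply A⁻¹ w) = w := by
      rw [← mApply_mul, Matrix.mul_nonsing_inv A ((Matrix.isUnit_iff_isUnit_det A).1 hA),
        mApply_one]
    have hcoer := hsym (mApply A⁻¹ w)
    have hnorm := norm_mApply_le A (mApply A⁻¹ w)
    rw [hAu] at hcoer hnorm
    rw [real_inner_comm] at hcoer
    have hw : ‖w‖ ≤ L * ‖mApply A⁻¹ w‖ := hnorm.trans (by gcongr)
    calc m / (2 * L ^ 2) * ‖w‖ ^ 2 ≤ m / (2 * L ^ 2) * (L * ‖mApply A⁻¹ w‖) ^ 2 := by gcongr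
      _ = m / 2 * ‖mApply A⁻¹ w‖ ^ 2 := by field_simp
      _ ≤ ⟪w, mApply A⁻¹ w⟫ := hcoer
  refine ⟨hA, key, fun w => ?_⟩
  rw [mApply_neg, inner_neg_right]
  calc -⟪w, mApply A⁻¹ w⟫ ≤ -(m / (2 * L ^ 2) * ‖w‖ ^ 2) := neg_le_neg (key w)
    _ = -(m / 2) * (1 / L) ^ 2 * ‖w‖ ^ 2 := by field_simp
end

section
/- Under the standing assumptions on G₀ and Φ, for every p ∈ 𝒫 the social-cost gradient ∇Φ(x*(p)) is a descent direction for the planner objective Φ∘x*: the directional derivative of p ↦ Φ(x*(p)) at p in the direction ∇Φ(x*(p)) equals ∇Φ(x*(p))ᵀ Sym(Dx*(p)) ∇Φ(x*(p)) ≤ 0, where Dx*(p) = −(DG₀(x*(p)))⁻¹, and this quantity equals zero if and only if p = p† := −G₀(x†). -/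
open scoped RealInnerProductSpace

/-- Symmetrization `(T + Tᵀ)/2` of a continuous linear map on Euclidean space. -/
noncomputable def symCLM {n : ℕ}
    (T : EuclideanSpace ℝ (Fin n) →L[ℝ] EuclideanSpace ℝ (Fin n)) :
    EuclideanSpace ℝ (Fin n) →L[ℝ] EuclideanSpace ℝ (Fin n) :=
  (1 / 2 : ℝ) • (T + ContinuousLinearMap.adjoint T)

/-- First-order lower bound for a strongly convex function at a point of differentiability. -/
theorem StrongConvexOn.add_inner_add_le_of_hasGradientAt {E : Type*} [NormedAddCommGroup E]
    [InnerProductSpace ℝ E] [CompleteSpace E] {s : Set E} {μ : ℝ} {f : E → ℝ} {g x y : E}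
    (hf : StrongConvexOn s μ f) (hg : HasGradientAt f g x) (hx : x ∈ s) (hy : y ∈ s) :
    f x + ⟪g, y - x⟫ + μ / 2 * ‖y - x‖ ^ 2 ≤ f y := by
  have hlim := (hg.hasFDerivAt.hasLineDerivAt (y - x)).tendsto_slope_zero_right
  have hbound : Filter.Tendsto (fun t : ℝ => f y - f x - (1 - t) * (μ / 2 * ‖y - x‖ ^ 2))
      (nhdsWithin 0 (Set.Ioi 0)) (nhds (f y - f x - (1 - 0) * (μ / 2 * ‖y - x‖ ^ 2))) := by
    refine (Continuous.tendsto ?_ 0).mono_left nhdsWithin_le_nhds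
    fun_prop
  have hle := le_of_tendsto_of_tendsto hlim hbound <| by
    filter_upwards [Ioo_mem_nhdsGT (zero_lt_one' ℝ)] with t ht
    have hconv := hf.2 hx hy (sub_nonneg.2 ht.2.le) ht.1.le (by ring)
    have hpt : (1 - t) • x + t • y = x + t • (y - x) := by module
    rw [hpt, norm_sub_rev x y] at hconv
    simp only [smul_eq_mul] at hconv ⊢
    rw [inv_mul_le_iff₀ ht.1]
    linarith
  simp only [InnerProductSpace.toDual_apply_apply] at hle
  linarith

theorem inner_symCLM_self {n : ℕ}
    (T : EuclideanSpace ℝ (Fin n) →L[ℝ] EuclideanSpace ℝ (Fin n))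
    (w : EuclideanSpace ℝ (Fin n)) : ⟪w, symCLM T w⟫ = ⟪w, T w⟫ := by
  simp only [symCLM, smul_apply, add_apply,
    inner_smul_right, inner_add_right, ContinuousLinearMap.adjoint_inner_right,
    real_inner_comm w (T w)]
  ring

theorem stmt9 {n : ℕ} (a b : Fin n → ℝ) (hab : ∀ i, a i < b i)
    (𝒳 : Set (EuclideanSpace ℝ (Fin n)))
    (h𝒳 : 𝒳 = {x : EuclideanSpace ℝ (Fin n) | ∀ i, x i ∈ Set.Icc (a i) (b i)})
    (G₀ : EuclideanSpace ℝ (Fin n) → EuclideanSpace ℝ (Fin n))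
    (DG₀ : EuclideanSpace ℝ (Fin n) →
      EuclideanSpace ℝ (Fin n) →L[ℝ] EuclideanSpace ℝ (Fin n))
    (U : Set (EuclideanSpace ℝ (Fin n))) (hU : IsOpen U) (hXU : 𝒳 ⊆ U)
    (hG₀ : ∀ x ∈ U, HasFDerivAt G₀ (DG₀ x) x)
    (m : ℝ) (hm : 0 < m)
    (hsym : ∀ x ∈ 𝒳, ∀ w, ⟪w, symCLM (DG₀ x) w⟫ ≥ m / 2 * ‖w‖ ^ 2)
    -- `x*` is the response map: the inverse of `x ↦ −G₀(x)` from `int 𝒳` onto `𝒫`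
    (xstar : EuclideanSpace ℝ (Fin n) → EuclideanSpace ℝ (Fin n))
    (hmaps : Set.MapsTo xstar ((fun x => -G₀ x) '' interior 𝒳) (interior 𝒳))
    (hinv₁ : ∀ p ∈ (fun x => -G₀ x) '' interior 𝒳, G₀ (xstar p) = -p)
    (hinv₂ : ∀ x ∈ interior 𝒳, xstar (-G₀ x) = x)
    -- `Dx*(p) = −(DG₀(x*(p)))⁻¹` is the Jacobian of `x*` at `p`
    (Dxstar : EuclideanSpace ℝ (Fin n) →
      EuclideanSpace ℝ (Fin n) →L[ℝ] EuclideanSpace ℝ (Fin n))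
    (hDx : ∀ p ∈ (fun x => -G₀ x) '' interior 𝒳,
      HasFDerivAt xstar (Dxstar p) p ∧
      (DG₀ (xstar p)).comp (Dxstar p) =
        -ContinuousLinearMap.id ℝ (EuclideanSpace ℝ (Fin n)) ∧
      (Dxstar p).comp (DG₀ (xstar p)) =
        -ContinuousLinearMap.id ℝ (EuclideanSpace ℝ (Fin n)))
    -- the planner's social cost `Φ`
    (Φ : EuclideanSpace ℝ (Fin n) → ℝ)
    (gradΦ : EuclideanSpace ℝ (Fin n) → EuclideanSpace ℝ (Fin n))
    (hΦ : ∀ x, HasGradientAt Φ (gradΦ x) x)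
    (μΦ : ℝ) (hμΦ : 0 < μΦ) (hΦconv : StrongConvexOn 𝒳 μΦ Φ)
    (xdag : EuclideanSpace ℝ (Fin n)) (hxdag : xdag ∈ interior 𝒳)
    (hmin : ∀ x ∈ 𝒳, Φ xdag ≤ Φ x) :
    ∀ p ∈ (fun x => -G₀ x) '' interior 𝒳,
      lineDeriv ℝ (fun q => Φ (xstar q)) p (gradΦ (xstar p)) =
        ⟪gradΦ (xstar p), symCLM (Dxstar p) (gradΦ (xstar p))⟫ ∧
      ⟪gradΦ (xstar p), symCLM (Dxstar p) (gradΦ (xstar p))⟫ ≤ 0 ∧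
      (⟪gradΦ (xstar p), symCLM (Dxstar p) (gradΦ (xstar p))⟫ = 0 ↔ p = -G₀ xdag) := by
  intro p hp
  obtain ⟨hD, hAD, -⟩ := hDx p hp
  have hxint := hmaps hp
  have hx := interior_subset hxint
  set g := gradΦ (xstar p) with hg
  set v := Dxstar p g with hv
  have hAv : DG₀ (xstar p) v = -g := by
    simpa using congrArg (fun T => T g) hAD
  have hcoer : ⟪g, v⟫ ≤ -(m / 2 * ‖v‖ ^ 2) := by
    have h := hsym _ hx v
    rw [inner_symCLM_self, hAv, inner_neg_right, real_inner_comm] at h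
    linarith
  have hvsq : 0 ≤ m / 2 * ‖v‖ ^ 2 := by positivity
  rw [inner_symCLM_self, ← hv]
  refine ⟨?_, by linarith, fun h => ?_, fun h => ?_⟩
  · have hcomp := (hΦ (xstar p)).hasFDerivAt.comp p hD
    simpa [Function.comp_def] using (hcomp.hasLineDerivAt g).lineDeriv
  · have hv0 : v = 0 := by
      have : ‖v‖ ^ 2 = 0 := by
        have : 0 ≤ ‖v‖ ^ 2 := by positivity
        nlinarith
      simpa using this
    have hg0 : g = 0 := by simpa [hv0] using hAv.symm
    have hfirst := hΦconv.add_inner_add_le_of_hasGradientAt (hΦ (xstar p)) hx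
      (interior_subset hxdag)
    rw [← hg, hg0, inner_zero_left] at hfirst
    have hle := hmin _ hx
    have hd : xdag - xstar p = 0 := by
      have : ‖xdag - xstar p‖ ^ 2 = 0 := by
        have : 0 ≤ ‖xdag - xstar p‖ ^ 2 := by positivity
        nlinarith
      simpa using this
    rw [sub_eq_zero.1 hd, hinv₁ p hp, neg_neg]
  · have hxp : xstar p = xdag := by rw [h, hinv₂ _ hxdag]
    have hloc : IsLocalMin Φ xdag :=
      Filter.mem_of_superset (mem_interior_iff_mem_nhds.1 hxdag) hmin
    have hg0 : g = 0 := by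
      simpa [hg, hxp] using hloc.hasFDerivAt_eq_zero (hΦ xdag).hasFDerivAt
    rw [hg0, inner_zero_left]
end
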